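/- arXiv:1504.01307 — 3 statements merged into one kernel-verified Lean document; each statement's English description precedes it below -/
import Mathlib

section
/- The map φ sending the primitive indefinite binary quadratic form (a,b,c) to the matrix M_{[a,b,c]} is a bijection from the set of primitive indefinite binary quadratic forms onto the set of primitive hyperbolic elements of SL₂(ℤ) with trace greater than 2. -/
open Matrix

/-- The matrix of multiplication by a unit attached to the form `(a, b, c)`. -/
def automorph (a b c x u : ℤ) : Matrix (Fin 2) (Fin 2) ℤ :=
  !![x, -c * u; a * u, x + b * u]

theorem automorph_mul (a b c x u y v : ℤ) :
    automorph a b c x u * automorph a b c y v =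
      automorph a b c (x * y - a * c * u * v) (x * v + u * y + b * u * v) := by
  ext i j
  fin_cases i <;> fin_cases j <;> simp [automorph, Matrix.mul_apply, Fin.sum_univ_two] <;> ring

theorem four_mul_automorph_norm (a b c x u : ℤ) :
    (2 * x + b * u) ^ 2 - (b ^ 2 - 4 * a * c) * u ^ 2 = 4 * (x ^ 2 + b * x * u + a * c * u ^ 2) := by
  ring

/-- Every positive solution of the Pell equation comes from a power of the fundamental one. -/
theorem exists_automorph_eq_pow {a b c x₀ u₀ : ℤ} (hd : 0 < b ^ 2 - 4 * a * c)
    (h₀ : x₀ ^ 2 + b * x₀ * u₀ + a * c * u₀ ^ 2 = 1) (hu₀ : 0 < u₀) (ht₀ : 0 < 2 * x₀ + b * u₀)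
    (hmin : ∀ x u : ℤ, x ^ 2 + b * x * u + a * c * u ^ 2 = 1 → 0 < u → 0 < 2 * x + b * u →
      2 * x₀ + b * u₀ ≤ 2 * x + b * u) (n : ℕ) :
    ∀ x u : ℤ, x ^ 2 + b * x * u + a * c * u ^ 2 = 1 → 0 < u → 0 < 2 * x + b * u →
      2 * x + b * u ≤ n → ∃ k : ℕ, 1 ≤ k ∧ automorph a b c x u = automorph a b c x₀ u₀ ^ k := by
  induction n with
  | zero => intro x u _ _ ht hn; simp at hn; omega
  | succ n ih =>
    intro x u h hu ht hn
    have p₀ := four_mul_automorph_norm a b c x₀ u₀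
    have p := four_mul_automorph_norm a b c x u
    rw [h₀] at p₀
    rw [h] at p
    have hle := hmin x u h hu ht
    rcases hle.eq_or_lt with heq | hlt
    · refine ⟨1, le_rfl, ?_⟩
      rw [← heq] at p
      have h2 : (b ^ 2 - 4 * a * c) * u ^ 2 = (b ^ 2 - 4 * a * c) * u₀ ^ 2 := by linarith
      have h3 := mul_left_cancel₀ hd.ne' h2
      have hueq : u = u₀ := (pow_left_inj₀ hu.le hu₀.le two_ne_zero).1 h3
      subst hueq
      have : x = x₀ := by linarith
      rw [this, pow_one]
    · set x' := x * x₀ + b * x * u₀ + a * c * u * u₀ with hx'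
      set u' := u * x₀ - x * u₀ with hu'
      have ht' : 2 * (2 * x' + b * u') =
          (2 * x + b * u) * (2 * x₀ + b * u₀) - (b ^ 2 - 4 * a * c) * u * u₀ := by
        rw [hx', hu']; ring
      have hu2 : 2 * u' = u * (2 * x₀ + b * u₀) - (2 * x + b * u) * u₀ := by
        rw [hu']; ring
      have hnorm : x' ^ 2 + b * x' * u' + a * c * u' ^ 2 = 1 := by
        have : x' ^ 2 + b * x' * u' + a * c * u' ^ 2 = (x ^ 2 + b * x * u + a * c * u ^ 2) *
            (x₀ ^ 2 + b * x₀ * u₀ + a * c * u₀ ^ 2) := by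
          rw [hx', hu']; ring
        rw [this, h, h₀]; rfl
      have ht2 : 2 * (2 * x + b * u) =
          (2 * x' + b * u') * (2 * x₀ + b * u₀) + (b ^ 2 - 4 * a * c) * (u' * u₀) := by
        have : (2 * x' + b * u') * (2 * x₀ + b * u₀) + (b ^ 2 - 4 * a * c) * (u' * u₀) =
            2 * (2 * x + b * u) * (x₀ ^ 2 + b * x₀ * u₀ + a * c * u₀ ^ 2) := by
          rw [hx', hu']; ring
        rw [this, h₀, mul_one]
      have hmul : automorph a b c x' u' * automorph a b c x₀ u₀ = automorph a b c x u := by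
        rw [automorph_mul]
        congr 1
        · have : x' * x₀ - a * c * u' * u₀ =
              x * (x₀ ^ 2 + b * x₀ * u₀ + a * c * u₀ ^ 2) := by rw [hx', hu']; ring
          rw [this, h₀, mul_one]
        · have : x' * u₀ + u' * x₀ + b * u' * u₀ =
              u * (x₀ ^ 2 + b * x₀ * u₀ + a * c * u₀ ^ 2) := by rw [hx', hu']; ring
          rw [this, h₀, mul_one]
      generalize 2 * x + b * u = t at *
      generalize 2 * x₀ + b * u₀ = t₀ at *
      generalize hdd : b ^ 2 - 4 * a * c = d at *
      have hsq : t₀ ^ 2 < t ^ 2 := by nlinarith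
      have husq : u₀ ^ 2 < u ^ 2 := by
        have : d * u₀ ^ 2 < d * u ^ 2 := by linarith
        exact lt_of_mul_lt_mul_left this hd.le
      have hupos : 0 < u' := by
        have : t * u₀ < u * t₀ := by
          refine lt_of_pow_lt_pow_left₀ 2 (by positivity) ?_
          have e : (u * t₀) ^ 2 - (t * u₀) ^ 2 = 4 * (u ^ 2 - u₀ ^ 2) := by
            linear_combination u ^ 2 * p₀ - u₀ ^ 2 * p
          linarith
        linarith
      have htpos : 0 < 2 * x' + b * u' := by
        have : d * u * u₀ < t * t₀ := by
          refine lt_of_pow_lt_pow_left₀ 2 (by positivity) ?_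
          have e : (t * t₀) ^ 2 - (d * u * u₀) ^ 2 = 4 * t₀ ^ 2 + 4 * (d * u ^ 2) := by
            linear_combination t₀ ^ 2 * p + d * u ^ 2 * p₀
          have : 0 < 4 * t₀ ^ 2 + 4 * (d * u ^ 2) := by positivity
          linarith
        linarith
      have ht₀2 : 2 < t₀ := by
        have : 0 < d * u₀ ^ 2 := by positivity
        nlinarith
      have hlt' : 2 * x' + b * u' < t := by
        have : 0 < d * (u' * u₀) := by positivity
        nlinarith
      obtain ⟨k, hk, e⟩ := ih x' u' hnorm hupos htpos (by push_cast at hn; linarith)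
      exact ⟨k + 1, by omega, by rw [pow_succ, ← e, hmul]⟩

theorem sq_eq_of_det_eq_one {δ : Matrix (Fin 2) (Fin 2) ℤ} (h : δ.det = 1) :
    δ * δ = δ.trace • δ - 1 := by
  rw [Matrix.det_fin_two] at h
  ext i j
  fin_cases i <;> fin_cases j <;>
    simp [Matrix.mul_apply, Matrix.trace_fin_two, -zsmul_eq_mul] <;> linarith

theorem exists_pow_eq_smul_add_smul {δ : Matrix (Fin 2) (Fin 2) ℤ} (h : δ.det = 1) (k : ℕ) :
    ∃ U V : ℤ, δ ^ k = U • δ + V • (1 : Matrix (Fin 2) (Fin 2) ℤ) := by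
  induction k with
  | zero => exact ⟨0, 1, by simp⟩
  | succ k ih =>
    obtain ⟨U, V, e⟩ := ih
    refine ⟨U * δ.trace + V, -U, ?_⟩
    rw [pow_succ, e, add_mul, smul_mul_assoc, sq_eq_of_det_eq_one h, smul_mul_assoc, one_mul]
    module

theorem abs_trace_pow_lt_succ {δ : Matrix (Fin 2) (Fin 2) ℤ} (h : δ.det = 1)
    (hs : 2 < |δ.trace|) (k : ℕ) : |(δ ^ k).trace| < |(δ ^ (k + 1)).trace| := by
  induction k with
  | zero => simpa using hs
  | succ k ih =>
    have e : (δ ^ (k + 1 + 1)).trace = δ.trace * (δ ^ (k + 1)).trace - (δ ^ k).trace := by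
      rw [pow_succ, pow_succ, mul_assoc, sq_eq_of_det_eq_one h, mul_sub, mul_smul_comm]
      simp [-zsmul_eq_mul]
    have h1 := abs_sub_abs_le_abs_sub (δ.trace * (δ ^ (k + 1)).trace) (δ ^ k).trace
    rw [← e, abs_mul] at h1
    have := abs_nonneg (δ ^ (k + 1)).trace
    nlinarith

theorem abs_trace_lt_abs_trace_pow {δ : Matrix (Fin 2) (Fin 2) ℤ} (h : δ.det = 1)
    (hs : 2 < |δ.trace|) {k : ℕ} (hk : 2 ≤ k) : |δ.trace| < |(δ ^ k).trace| := by
  simpa using strictMono_nat_of_lt_succ (abs_trace_pow_lt_succ h hs) (show 1 < k by omega)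

theorem dvd_of_dvd_mul_of_gcd_eq_one {a b c : ℤ} (h : Int.gcd a (Int.gcd b c) = 1) {U u : ℤ}
    (ha : U ∣ u * a) (hb : U ∣ u * b) (hc : U ∣ u * c) : U ∣ u := by
  have h1 : U ∣ u * (Int.gcd b c : ℤ) := by
    rw [Int.gcd_eq_gcd_ab, mul_add, ← mul_assoc, ← mul_assoc]
    exact dvd_add (hb.mul_right _) (hc.mul_right _)
  have h2 : U ∣ u * (Int.gcd a (Int.gcd b c) : ℤ) := by
    rw [Int.gcd_eq_gcd_ab a, mul_add, ← mul_assoc, ← mul_assoc]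
    exact dvd_add (ha.mul_right _) (h1.mul_right _)
  simpa [h] using h2

theorem automorph_ne_pow {a b c x₀ u₀ : ℤ} (hg : Int.gcd a (Int.gcd b c) = 1)
    (hd : 0 < b ^ 2 - 4 * a * c) (hu₀ : 0 < u₀) (ht₀ : 0 < 2 * x₀ + b * u₀)
    (hmin : ∀ t u : ℤ, 0 < t → 0 < u → t ^ 2 - (b ^ 2 - 4 * a * c) * u ^ 2 = 4 →
      2 * x₀ + b * u₀ ≤ t) {δ : Matrix (Fin 2) (Fin 2) ℤ} (hδ : δ.det = 1) {k : ℕ} (hk : 2 ≤ k) :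
    automorph a b c x₀ u₀ ≠ δ ^ k := by
  intro e
  obtain ⟨U, V, hUV⟩ := exists_pow_eq_smul_add_smul hδ k
  have htr : (δ ^ k).trace = 2 * x₀ + b * u₀ := by
    rw [← e]; simp [automorph, Matrix.trace, Fin.sum_univ_two]; ring
  rw [hUV] at e
  have e00 := congrFun (congrFun e 0) 0
  have e01 := congrFun (congrFun e 0) 1
  have e10 := congrFun (congrFun e 1) 0
  have e11 := congrFun (congrFun e 1) 1
  simp [automorph, -zsmul_eq_mul, -zsmul_one] at e00 e01 e10 e11
  obtain ⟨v, hv⟩ : U ∣ u₀ := by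
    refine dvd_of_dvd_mul_of_gcd_eq_one hg ⟨δ 1 0, by linarith⟩ ⟨δ 1 1 - δ 0 0, ?_⟩
      ⟨-δ 0 1, by linarith⟩
    linear_combination e11 - e00
  have hU : U ≠ 0 := by rintro rfl; simp at hv; omega
  have hv0 : v ≠ 0 := by rintro rfl; simp at hv; omega
  subst hv
  have d10 : δ 1 0 = a * v := mul_left_cancel₀ hU (by linear_combination -e10)
  have d01 : δ 0 1 = -c * v := mul_left_cancel₀ hU (by linear_combination -e01)
  have d11 : δ 1 1 - δ 0 0 = b * v := mul_left_cancel₀ hU (by linear_combination e00 - e11)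
  have hs : |δ.trace| ^ 2 - (b ^ 2 - 4 * a * c) * |v| ^ 2 = 4 := by
    rw [Matrix.det_fin_two, d10, d01] at hδ
    rw [sq_abs, sq_abs, Matrix.trace_fin_two]
    linear_combination 4 * hδ + (δ 1 1 - δ 0 0 + b * v) * d11
  have hvp : 0 < |v| := abs_pos.2 hv0
  have hs2 : 2 < |δ.trace| := by
    have := abs_nonneg δ.trace
    have : 0 < (b ^ 2 - 4 * a * c) * |v| ^ 2 := by positivity
    nlinarith
  have h1 := hmin _ _ (by linarith) hvp hs
  have h2 := abs_trace_lt_abs_trace_pow hδ hs2 hk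
  rw [htr, abs_of_pos ht₀] at h2
  linarith

theorem gcd_mul_gcd_mul {a b c : ℤ} (h : Int.gcd a (Int.gcd b c) = 1) {u : ℤ} (hu : 0 < u) :
    (Int.gcd (a * u) (Int.gcd (b * u) (c * u)) : ℤ) = u := by
  rw [Int.gcd_mul_right, Nat.cast_mul, Int.natCast_natAbs, abs_of_pos hu, Int.gcd_mul_right, h]
  simp [abs_of_pos hu]

theorem automorph_injective {a b c x u a' b' c' x' u' : ℤ}
    (h : Int.gcd a (Int.gcd b c) = 1) (h' : Int.gcd a' (Int.gcd b' c') = 1)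
    (hu : 0 < u) (hu' : 0 < u') (e : automorph a b c x u = automorph a' b' c' x' u') :
    a = a' ∧ b = b' ∧ c = c' := by
  have e00 := congrFun (congrFun e 0) 0
  have e01 := congrFun (congrFun e 0) 1
  have e10 := congrFun (congrFun e 1) 0
  have e11 := congrFun (congrFun e 1) 1
  simp only [automorph, of_apply, cons_val', cons_val_zero, cons_val_one, cons_val_fin_one]
    at e00 e01 e10 e11
  have ec : c * u = c' * u' := by linarith
  have eb : b * u = b' * u' := by linarith
  have hueq : u = u' := by
    rw [← gcd_mul_gcd_mul h hu, ← gcd_mul_gcd_mul h' hu', e10, eb, ec]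
  subst hueq
  exact ⟨mul_right_cancel₀ hu.ne' e10, mul_right_cancel₀ hu.ne' eb, mul_right_cancel₀ hu.ne' ec⟩

/-- Dividing a nonzero triple by its gcd gives a primitive triple. -/
theorem exists_eq_mul_gcd_eq_one {p q r : ℤ} (h : ¬(p = 0 ∧ q = 0 ∧ r = 0)) :
    ∃ a b c u : ℤ, 0 < u ∧ Int.gcd a (Int.gcd b c) = 1 ∧ p = a * u ∧ q = b * u ∧ r = c * u := by
  set g := Int.gcd p (Int.gcd q r) with hg
  have hpos : 0 < g := by
    rw [Nat.pos_iff_ne_zero]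
    intro h0
    rw [hg, Int.gcd_eq_zero_iff] at h0
    have := h0.2
    norm_cast at this
    rw [Int.gcd_eq_zero_iff] at this
    exact h ⟨h0.1, this⟩
  have hq : (g : ℤ) ∣ (Int.gcd q r : ℤ) := Int.gcd_dvd_right ..
  obtain ⟨a, ha⟩ : (g : ℤ) ∣ p := Int.gcd_dvd_left ..
  obtain ⟨b, hb⟩ : (g : ℤ) ∣ q := hq.trans (Int.gcd_dvd_left ..)
  obtain ⟨c, hc⟩ : (g : ℤ) ∣ r := hq.trans (Int.gcd_dvd_right ..)
  refine ⟨a, b, c, g, by exact_mod_cast hpos, ?_, by linarith, by linarith, by linarith⟩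
  have e : g = g * Int.gcd a (Int.gcd b c) := by
    conv_lhs => rw [hg, ha, hb, hc, Int.gcd_mul_left g b c, Nat.cast_mul, Int.natAbs_natCast,
      Int.gcd_mul_left, Int.natAbs_natCast]
  exact (Nat.eq_of_mul_eq_mul_left hpos (by rw [mul_one]; exact e)).symm

theorem exists_eq_automorph {m : Matrix (Fin 2) (Fin 2) ℤ} (hdet : m.det = 1)
    (htr : 2 < m.trace) :
    ∃ a b c x u : ℤ, 0 < u ∧ Int.gcd a (Int.gcd b c) = 1 ∧ 0 < b ^ 2 - 4 * a * c ∧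
      ¬IsSquare (b ^ 2 - 4 * a * c) ∧ m = automorph a b c x u := by
  rw [Matrix.det_fin_two] at hdet
  rw [Matrix.trace_fin_two] at htr
  obtain ⟨a, b, c, u, hu, hg, ha, hb, hc⟩ :=
    exists_eq_mul_gcd_eq_one (p := m 1 0) (q := m 1 1 - m 0 0) (r := -m 0 1) (by
      rintro ⟨h1, h2, -⟩
      rw [h1] at hdet
      have : m 1 1 = m 0 0 := by linarith
      rw [this] at hdet htr
      nlinarith)
  have key : (m 0 0 + m 1 1) ^ 2 - (b ^ 2 - 4 * a * c) * u ^ 2 = 4 := by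
    linear_combination 4 * hdet + (m 1 1 - m 0 0 + b * u) * hb - 4 * m 1 0 * hc - 4 * c * u * ha
  refine ⟨a, b, c, m 0 0, u, hu, hg, ?_, ?_, ?_⟩
  · have : 0 < (b ^ 2 - 4 * a * c) * u ^ 2 := by nlinarith
    exact pos_of_mul_pos_left this (by positivity)
  · rintro ⟨e, he⟩
    rw [he] at key
    have h1 : |e * u| ^ 2 = (m 0 0 + m 1 1) ^ 2 - 4 := by rw [sq_abs]; linear_combination -key
    have h2 := abs_nonneg (e * u)
    generalize |e * u| = y at *
    have h3 : y < m 0 0 + m 1 1 := by nlinarith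
    have h4 : y ≤ m 0 0 + m 1 1 - 1 := by omega
    nlinarith
  · ext i j
    fin_cases i <;> fin_cases j <;> simp [automorph] <;> linarith

/-- A solution of the Pell equation determines an integral automorph. -/
theorem exists_automorph_of_pell {a b c t u : ℤ} (h : t ^ 2 - (b ^ 2 - 4 * a * c) * u ^ 2 = 4) :
    ∃ x : ℤ, t = 2 * x + b * u ∧
      !![(t - b * u) / 2, -c * u; a * u, (t + b * u) / 2] = automorph a b c x u := by
  have hev : Even (t - b * u) := by
    have h1 : Even ((t - b * u) * (t + b * u)) := ⟨2 - 2 * a * c * u ^ 2, by linear_combination h⟩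
    rcases Int.even_mul.1 h1 with h2 | h2
    · exact h2
    · have : t - b * u = t + b * u - 2 * (b * u) := by ring
      rw [this]
      exact h2.sub (even_two_mul _)
  obtain ⟨x, hx⟩ := hev
  refine ⟨x, by linarith, ?_⟩
  have h1 : (t - b * u) / 2 = x := by omega
  have h2 : (t + b * u) / 2 = x + b * u := by omega
  rw [h1, h2, automorph]

theorem stmt_4
    (Forms : Set (ℤ × ℤ × ℤ))
    (hForms : Forms = {f : ℤ × ℤ × ℤ |
      Int.gcd f.1 (Int.gcd f.2.1 f.2.2) = 1 ∧
      0 < f.2.1 ^ 2 - 4 * f.1 * f.2.2 ∧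
      ¬ IsSquare (f.2.1 ^ 2 - 4 * f.1 * f.2.2)})
    (φ : ℤ × ℤ × ℤ → Matrix (Fin 2) (Fin 2) ℤ)
    (hφ : ∀ f ∈ Forms, ∃ t₀ u₀ : ℤ, 0 < t₀ ∧ 0 < u₀ ∧
      t₀ ^ 2 - (f.2.1 ^ 2 - 4 * f.1 * f.2.2) * u₀ ^ 2 = 4 ∧
      (∀ t u : ℤ, 0 < t → 0 < u →
        t ^ 2 - (f.2.1 ^ 2 - 4 * f.1 * f.2.2) * u ^ 2 = 4 → t₀ ≤ t) ∧
      φ f = !![(t₀ - f.2.1 * u₀) / 2, -f.2.2 * u₀;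
               f.1 * u₀, (t₀ + f.2.1 * u₀) / 2]) :
    Set.BijOn φ Forms
      {m : Matrix (Fin 2) (Fin 2) ℤ | m.det = 1 ∧ 2 < m.trace ∧
        ¬ ∃ (δ : Matrix (Fin 2) (Fin 2) ℤ) (k : ℕ),
            δ.det = 1 ∧ 2 ≤ k ∧ m = δ ^ k} := by
  have hmem : ∀ a b c : ℤ, (a, b, c) ∈ Forms ↔ Int.gcd a (Int.gcd b c) = 1 ∧
      0 < b ^ 2 - 4 * a * c ∧ ¬IsSquare (b ^ 2 - 4 * a * c) := by
    intro a b c; rw [hForms]; rfl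
  have hdata : ∀ a b c : ℤ, (a, b, c) ∈ Forms → ∃ x₀ u₀ : ℤ, 0 < u₀ ∧ 0 < 2 * x₀ + b * u₀ ∧
      x₀ ^ 2 + b * x₀ * u₀ + a * c * u₀ ^ 2 = 1 ∧
      (∀ t u : ℤ, 0 < t → 0 < u → t ^ 2 - (b ^ 2 - 4 * a * c) * u ^ 2 = 4 →
        2 * x₀ + b * u₀ ≤ t) ∧ φ (a, b, c) = automorph a b c x₀ u₀ := by
    intro a b c hf
    obtain ⟨t₀, u₀, ht, hu, hp, hmin, he⟩ := hφ _ hf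
    dsimp only at hp hmin he
    obtain ⟨x, rfl, hx⟩ := exists_automorph_of_pell hp
    rw [hx] at he
    exact ⟨x, u₀, hu, ht, by linarith [four_mul_automorph_norm a b c x u₀], hmin, he⟩
  refine ⟨?_, ?_, ?_⟩
  · rintro ⟨a, b, c⟩ hf
    obtain ⟨x, u, hu, ht, hn, hmin, he⟩ := hdata a b c hf
    obtain ⟨hg, hd, -⟩ := (hmem a b c).1 hf
    refine ⟨?_, ?_, ?_⟩
    · rw [he, automorph, Matrix.det_fin_two_of]
      linarith
    · have e : (automorph a b c x u).trace = 2 * x + b * u := by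
        rw [automorph, Matrix.trace_fin_two_of]; ring
      rw [he, e]
      have h1 := four_mul_automorph_norm a b c x u
      have h2 : 0 < (b ^ 2 - 4 * a * c) * u ^ 2 := by positivity
      nlinarith
    · rintro ⟨δ, k, hδ, hk, e⟩
      exact automorph_ne_pow hg hd hu ht hmin hδ hk (he ▸ e)
  · rintro ⟨a, b, c⟩ hf ⟨a', b', c'⟩ hf' e
    obtain ⟨x, u, hu, -, -, -, he⟩ := hdata a b c hf
    obtain ⟨x', u', hu', -, -, -, he'⟩ := hdata a' b' c' hf'
    rw [he, he'] at e
    obtain ⟨rfl, rfl, rfl⟩ :=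
      automorph_injective ((hmem _ _ _).1 hf).1 ((hmem _ _ _).1 hf').1 hu hu' e
    rfl
  · rintro m ⟨hdet, htr, hprim⟩
    obtain ⟨a, b, c, x, u, hu, hg, hd, hsq, rfl⟩ := exists_eq_automorph hdet htr
    have hf := (hmem a b c).2 ⟨hg, hd, hsq⟩
    obtain ⟨x₀, u₀, hu₀, ht₀, hn₀, hmin, he⟩ := hdata a b c hf
    rw [automorph, Matrix.det_fin_two_of] at hdet
    rw [automorph, Matrix.trace_fin_two_of] at htr
    have ht : 0 < 2 * x + b * u := by linarith
    obtain ⟨k, hk, e⟩ := exists_automorph_eq_pow hd hn₀ hu₀ ht₀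
      (fun y v h hv hy => hmin _ _ hy hv (by rw [four_mul_automorph_norm, h]; rfl))
      (2 * x + b * u).toNat x u (by linarith) hu ht (Int.self_le_toNat _)
    refine ⟨(a, b, c), hf, ?_⟩
    rcases hk.eq_or_lt with rfl | hk
    · rw [he, e, pow_one]
    · refine absurd ⟨automorph a b c x₀ u₀, k, ?_, hk, e⟩ hprim
      rw [automorph, Matrix.det_fin_two_of]
      linarith
end

section
/- The map φ : (a,b,c) ↦ M_{[a,b,c]} commutes with the action of SL₂(ℤ): two primitive indefinite binary quadratic forms (a,b,c) and (a',b',c') are equivalent if and only if M_{[a,b,c]} and M_{[a',b',c']} are conjugate in SL₂(ℤ). -/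
open Matrix

/-- For a solution of the Pell equation, `t - b u` and `t + b u` are even. -/
theorem two_mul_half_of_pell {a b c t u : ℤ} (h : t ^ 2 - (b ^ 2 - 4 * a * c) * u ^ 2 = 4) :
    2 * ((t - b * u) / 2) = t - b * u ∧ 2 * ((t + b * u) / 2) = t + b * u := by
  have hprod : (2 : ℤ) ∣ (t - b * u) * (t + b * u) :=
    ⟨2 * (1 - a * c * u ^ 2), by linear_combination h⟩
  rcases Int.prime_two.dvd_or_dvd hprod with h2 | h2 <;> constructor <;> omega

/-- If `u` divides `u'` times each coefficient of a primitive form, then `u` divides `u'`. -/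
theorem dvd_of_dvd_mul_primitive {a b c u v : ℤ} (h : Int.gcd a (Int.gcd b c) = 1)
    (ha : u ∣ a * v) (hb : u ∣ b * v) (hc : u ∣ c * v) : u ∣ v := by
  have hbez : (1 : ℤ) = a * Int.gcdA a (Int.gcd b c) +
      (b * Int.gcdA b c + c * Int.gcdB b c) * Int.gcdB a (Int.gcd b c) := by
    rw [← Int.gcd_eq_gcd_ab b c, ← Int.gcd_eq_gcd_ab, h, Nat.cast_one]
  set x := Int.gcdA a (Int.gcd b c)
  set y := Int.gcdB a (Int.gcd b c)
  have hv : v = a * v * x + (b * v * (Int.gcdA b c * y) + c * v * (Int.gcdB b c * y)) := by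
    linear_combination v * hbez
  rw [hv]
  exact dvd_add (ha.mul_right _) (dvd_add (hb.mul_right _) (hc.mul_right _))

/-- Change of variables for binary quadratic forms, written on coefficients. -/
theorem transform_iff {a b c a' b' c' : ℤ} (γ : Matrix (Fin 2) (Fin 2) ℤ) :
    γᵀ * !![2 * a, b; b, 2 * c] * γ = !![2 * a', b'; b', 2 * c'] ↔
      a' = a * γ 0 0 ^ 2 + b * γ 0 0 * γ 1 0 + c * γ 1 0 ^ 2 ∧
      b' = 2 * a * γ 0 0 * γ 0 1 + b * (γ 0 0 * γ 1 1 + γ 0 1 * γ 1 0)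
        + 2 * c * γ 1 0 * γ 1 1 ∧
      c' = a * γ 0 1 ^ 2 + b * γ 0 1 * γ 1 1 + c * γ 1 1 ^ 2 := by
  rw [← Matrix.ext_iff]
  simp only [Fin.forall_fin_two, Matrix.mul_apply, Fin.sum_univ_two, Matrix.transpose_apply,
    Matrix.of_apply, Matrix.cons_val', Matrix.cons_val_zero, Matrix.cons_val_one,
    Matrix.cons_val_fin_one]
  constructor
  · rintro ⟨⟨h1, h2⟩, -, h4⟩
    exact ⟨by linarith, by linarith, by linarith⟩
  · rintro ⟨rfl, rfl, rfl⟩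
    refine ⟨⟨?_, ?_⟩, ?_, ?_⟩ <;> ring

/-- A matrix of determinant one intertwines the trace `t` matrices attached to `u • (a, b, c)` and
`u' • (a', b', c')` exactly when it transforms the first of these forms into the second. -/
theorem intertwine_iff {a b c a' b' c' u u' t x w x' w' : ℤ} {γ : Matrix (Fin 2) (Fin 2) ℤ}
    (hγ : γ.det = 1) (hx : 2 * x = t - b * u) (hw : 2 * w = t + b * u)
    (hx' : 2 * x' = t - b' * u') (hw' : 2 * w' = t + b' * u') :
    γ * !![x', -c' * u'; a' * u', w'] = !![x, -c * u; a * u, w] * γ ↔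
      γᵀ * !![2 * (a * u), b * u; b * u, 2 * (c * u)] * γ =
        !![2 * (a' * u'), b' * u'; b' * u', 2 * (c' * u')] := by
  rw [transform_iff, ← Matrix.ext_iff]
  rw [Matrix.det_fin_two] at hγ
  simp only [Fin.forall_fin_two, Matrix.mul_apply, Fin.sum_univ_two,
    Matrix.of_apply, Matrix.cons_val', Matrix.cons_val_zero, Matrix.cons_val_one,
    Matrix.cons_val_fin_one]
  generalize γ 0 0 = p, γ 0 1 = q, γ 1 0 = r, γ 1 1 = s at *
  have hwx : w - x = b * u := by linarith
  have hwx' : w' - x' = b' * u' := by linarith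
  constructor
  · rintro ⟨⟨h1, h2⟩, h3, h4⟩
    refine ⟨?_, ?_, ?_⟩
    · linear_combination p * h3 - r * h1 - a' * u' * hγ + p * r * hwx
    · linear_combination p * h4 - r * h2 - s * h1 + q * h3 - (w' - x') * hγ
        + (p * s + q * r) * hwx - hwx'
    · linear_combination q * h4 - s * h2 - c' * u' * hγ + q * s * hwx
  · rintro ⟨ha, hb, hc⟩
    refine ⟨⟨?_, ?_⟩, ?_, ?_⟩ <;> apply mul_left_cancel₀ (two_ne_zero (α := ℤ))
    · linear_combination p * hx' - p * hx - p * hb + 2 * q * ha - u * (b * p + 2 * c * r) * hγ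
    · linear_combination q * hw' - q * hx + q * hb - 2 * p * hc - u * (b * q + 2 * c * s) * hγ
    · linear_combination r * hx' - r * hw - r * hb + 2 * s * ha + u * (b * r + 2 * a * p) * hγ
    · linear_combination s * hw' - s * hw + s * hb - 2 * r * hc + u * (b * s + 2 * a * q) * hγ

/-- Proportional forms `u • (a, b, c)` and `u' • (a', b', c')` that are related by an integral
change of variables satisfy `u ∣ u'` as soon as `(a', b', c')` is primitive. -/
theorem dvd_of_transform {a b c a' b' c' u u' : ℤ} {γ : Matrix (Fin 2) (Fin 2) ℤ}
    (hprim : Int.gcd a' (Int.gcd b' c') = 1)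
    (h : γᵀ * !![2 * (a * u), b * u; b * u, 2 * (c * u)] * γ =
        !![2 * (a' * u'), b' * u'; b' * u', 2 * (c' * u')]) : u ∣ u' := by
  obtain ⟨ha, hb, hc⟩ := (transform_iff γ).1 h
  refine dvd_of_dvd_mul_primitive hprim ?_ ?_ ?_
  · exact ⟨a * γ 0 0 ^ 2 + b * γ 0 0 * γ 1 0 + c * γ 1 0 ^ 2, by rw [ha]; ring⟩
  · exact ⟨2 * a * γ 0 0 * γ 0 1 + b * (γ 0 0 * γ 1 1 + γ 0 1 * γ 1 0)
      + 2 * c * γ 1 0 * γ 1 1, by rw [hb]; ring⟩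
  · exact ⟨a * γ 0 1 ^ 2 + b * γ 0 1 * γ 1 1 + c * γ 1 1 ^ 2, by rw [hc]; ring⟩

/-- Scaling both forms by a nonzero integer does not change whether they are related. -/
theorem transform_smul_iff {a b c a' b' c' u : ℤ} (hu : u ≠ 0) (γ : Matrix (Fin 2) (Fin 2) ℤ) :
    γᵀ * !![2 * (a * u), b * u; b * u, 2 * (c * u)] * γ =
        !![2 * (a' * u), b' * u; b' * u, 2 * (c' * u)] ↔
      γᵀ * !![2 * a, b; b, 2 * c] * γ = !![2 * a', b'; b', 2 * c'] := by
  rw [transform_iff, transform_iff]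
  constructor
  · rintro ⟨ha, hb, hc⟩
    exact ⟨mul_right_cancel₀ hu (by linear_combination ha),
      mul_right_cancel₀ hu (by linear_combination hb),
      mul_right_cancel₀ hu (by linear_combination hc)⟩
  · rintro ⟨rfl, rfl, rfl⟩
    refine ⟨?_, ?_, ?_⟩ <;> ring

theorem stmt_5 (a b c a' b' c' d d' t₀ u₀ t₀' u₀' : ℤ)
    (hcop : Int.gcd a (Int.gcd b c) = 1)
    (hcop' : Int.gcd a' (Int.gcd b' c') = 1)
    (hd : d = b ^ 2 - 4 * a * c) (hd_pos : 0 < d) (hd_ns : ¬ IsSquare d)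
    (hd' : d' = b' ^ 2 - 4 * a' * c') (hd'_pos : 0 < d') (hd'_ns : ¬ IsSquare d')
    (ht₀ : 0 < t₀) (hu₀ : 0 < u₀)
    (hPell : t₀ ^ 2 - d * u₀ ^ 2 = 4)
    (hmin : ∀ t u : ℤ, 0 < t → 0 < u → t ^ 2 - d * u ^ 2 = 4 → t₀ ≤ t)
    (ht₀' : 0 < t₀') (hu₀' : 0 < u₀')
    (hPell' : t₀' ^ 2 - d' * u₀' ^ 2 = 4)
    (hmin' : ∀ t u : ℤ, 0 < t → 0 < u → t ^ 2 - d' * u ^ 2 = 4 → t₀' ≤ t)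
    (M M' : Matrix.SpecialLinearGroup (Fin 2) ℤ)
    (hM : (M : Matrix (Fin 2) (Fin 2) ℤ) =
      !![(t₀ - b * u₀) / 2, -c * u₀; a * u₀, (t₀ + b * u₀) / 2])
    (hM' : (M' : Matrix (Fin 2) (Fin 2) ℤ) =
      !![(t₀' - b' * u₀') / 2, -c' * u₀'; a' * u₀', (t₀' + b' * u₀') / 2]) :
    (∃ γ : Matrix.SpecialLinearGroup (Fin 2) ℤ,
        (γ : Matrix (Fin 2) (Fin 2) ℤ)ᵀ * !![2 * a, b; b, 2 * c] *
            (γ : Matrix (Fin 2) (Fin 2) ℤ) = !![2 * a', b'; b', 2 * c']) ↔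
      ∃ γ : Matrix.SpecialLinearGroup (Fin 2) ℤ, M' = γ * M * γ⁻¹ := by
  subst hd hd'
  obtain ⟨hx, hw⟩ := two_mul_half_of_pell hPell
  obtain ⟨hx', hw'⟩ := two_mul_half_of_pell hPell'
  constructor
  · rintro ⟨γ, hγ⟩
    have hdisc : b' ^ 2 - 4 * a' * c' = b ^ 2 - 4 * a * c := by
      have h := congrArg Matrix.det hγ
      simp only [Matrix.det_mul, Matrix.det_transpose, γ.det_coe, Matrix.det_fin_two_of] at h
      linear_combination h
    rw [hdisc] at hPell' hmin'
    have ht : t₀' = t₀ :=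
      le_antisymm (hmin' _ _ ht₀ hu₀ hPell) (hmin _ _ ht₀' hu₀' hPell')
    subst ht
    have hu : u₀' = u₀ := by
      have hsq : u₀' ^ 2 = u₀ ^ 2 :=
        mul_left_cancel₀ hd_pos.ne' (by linear_combination hPell - hPell')
      exact (pow_left_inj₀ hu₀'.le hu₀.le two_ne_zero).1 hsq
    subst hu
    have hcomm : γ * M' = M * γ := by
      apply Subtype.ext
      rw [Matrix.SpecialLinearGroup.coe_mul, Matrix.SpecialLinearGroup.coe_mul, hM, hM',
        intertwine_iff γ.det_coe hx hw hx' hw']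
      exact (transform_smul_iff hu₀.ne' _).2 hγ
    exact ⟨γ⁻¹, by rw [inv_inv, mul_assoc, ← hcomm, inv_mul_cancel_left]⟩
  · rintro ⟨γ, hγ⟩
    have hcomm : γ⁻¹ * M' = M * γ⁻¹ := by rw [hγ]; group
    have hcomm' : γ * M = M' * γ := by rw [hγ]; group
    have ht : t₀' = t₀ := by
      have h := congrArg Matrix.trace (congrArg Subtype.val hγ)
      rw [Matrix.SpecialLinearGroup.coe_mul, Matrix.trace_mul_comm,
        ← Matrix.SpecialLinearGroup.coe_mul, inv_mul_cancel_left, hM, hM',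
        Matrix.trace_fin_two_of, Matrix.trace_fin_two_of] at h
      linarith
    subst ht
    have h := congrArg Subtype.val hcomm
    have h' := congrArg Subtype.val hcomm'
    rw [Matrix.SpecialLinearGroup.coe_mul, Matrix.SpecialLinearGroup.coe_mul, hM, hM'] at h h'
    rw [intertwine_iff γ⁻¹.det_coe hx hw hx' hw'] at h
    rw [intertwine_iff γ.det_coe hx' hw' hx hw] at h'
    have hu : u₀' = u₀ := Int.dvd_antisymm hu₀'.le hu₀.le
      (dvd_of_transform hcop h') (dvd_of_transform hcop' h)
    subst hu
    exact ⟨γ⁻¹, (transform_smul_iff hu₀.ne' _).1 h⟩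
end

section
/- In the setting of the form Q(x,y) = ax² + cy²: (i) F_Q is invariant under left multiplication by M, i.e. for every real (or integer) 2×2 matrix N = [[α,β],[γ,δ]], F_Q applied to the entries of M·N equals F_Q(α,β,γ,δ); and (ii) for every X > 0, the set of left cosets ⟨M⟩·g with g ∈ SL₂(ℤ) and |F_Q(g)| ≤ X is finite (so the counting function P(X) is well defined), where ⟨M⟩ is the subgroup of SL₂(ℤ) generated by M and F_Q(g) denotes F_Q applied to the entries of g. -/
open Matrix

/-- The norm one element `x + y √(-ac)`, seen as a proper automorph of the form `a X² + c Y²`. -/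
def pellAutomorph (a c : ℤ) :
    Pell.Solution₁ (-a * c) →* Matrix.SpecialLinearGroup (Fin 2) ℤ where
  toFun s := ⟨!![s.x, -c * s.y; a * s.y, s.x], by
    rw [Matrix.det_fin_two_of]
    linear_combination s.prop⟩
  map_one' := by
    ext i j
    fin_cases i <;> fin_cases j <;> simp
  map_mul' s t := by
    apply Subtype.ext
    change !![(s * t).x, -c * (s * t).y; a * (s * t).y, (s * t).x] =
      !![s.x, -c * s.y; a * s.y, s.x] * !![t.x, -c * t.y; a * t.y, t.x]
    ext i j
    fin_cases i <;> fin_cases j <;>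
      simp [Matrix.mul_apply, Fin.sum_univ_two, Pell.Solution₁.x_mul, Pell.Solution₁.y_mul] <;> ring

theorem coe_pellAutomorph (a c : ℤ) (s : Pell.Solution₁ (-a * c)) :
    (pellAutomorph a c s : Matrix (Fin 2) (Fin 2) ℤ) =
      !![s.x, -c * s.y; a * s.y, s.x] := rfl

/-- The coefficients of the form `a X² + c Y²` after the substitution `g`. -/
def transformedCoeffs (a c : ℤ) (g : Matrix.SpecialLinearGroup (Fin 2) ℤ) : ℤ × ℤ × ℤ :=
  (a * g 0 0 ^ 2 + c * g 1 0 ^ 2, a * g 0 0 * g 0 1 + c * g 1 0 * g 1 1,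
    a * g 0 1 ^ 2 + c * g 1 1 ^ 2)

theorem exists_pellAutomorph_mul_eq {a c : ℤ} (ha : a ≠ 0) (hac : IsCoprime a c)
    {g h : Matrix.SpecialLinearGroup (Fin 2) ℤ}
    (hgh : transformedCoeffs a c g = transformedCoeffs a c h) :
    ∃ s : Pell.Solution₁ (-a * c), g = pellAutomorph a c s * h := by
  have hh := h.det_coe
  rw [Matrix.det_fin_two] at hh
  simp only [transformedCoeffs, Prod.mk.injEq] at hgh
  obtain ⟨h1, h2, h3⟩ := hgh
  obtain ⟨k, rfl⟩ : ∃ k, g = k * h := ⟨g * h⁻¹, by simp⟩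
  have hkd := k.det_coe
  rw [Matrix.det_fin_two] at hkd
  simp only [Matrix.SpecialLinearGroup.coe_mul, Matrix.mul_apply, Fin.sum_univ_two] at h1 h2 h3
  generalize h 0 0 = α at *
  generalize h 0 1 = β at *
  generalize h 1 0 = γ at *
  generalize h 1 1 = δ at *
  have e1 : a * k 0 0 ^ 2 + c * k 1 0 ^ 2 = a := by
    linear_combination δ ^ 2 * h1 - 2 * δ * γ * h2 + γ ^ 2 * h3
      - (a * k 0 0 ^ 2 + c * k 1 0 ^ 2 - a) * (α * δ - β * γ + 1) * hh
  have e2 : a * k 0 0 * k 0 1 + c * k 1 0 * k 1 1 = 0 := by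
    linear_combination (-δ * β) * h1 + (α * δ + β * γ) * h2 - γ * α * h3
      - (a * k 0 0 * k 0 1 + c * k 1 0 * k 1 1) * (α * δ - β * γ + 1) * hh
  have hps : k 1 1 = k 0 0 := by
    apply mul_left_cancel₀ ha
    linear_combination (-k 1 1) * e1 + k 1 0 * e2 + a * k 0 0 * hkd
  have hqr : a * k 0 1 = -(c * k 1 0) := by
    linear_combination (-k 0 1) * e1 + k 0 0 * e2 - c * k 1 0 * hkd
  obtain ⟨u, hu⟩ : a ∣ k 1 0 := hac.dvd_of_dvd_mul_left ⟨-k 0 1, by linear_combination hqr⟩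
  have hq : k 0 1 = -c * u := by
    apply mul_left_cancel₀ ha
    rw [hqr, hu]; ring
  refine ⟨Pell.Solution₁.mk (k 0 0) u ?_, ?_⟩
  · rw [hps, hq, hu] at hkd
    linear_combination hkd
  · congr 1
    ext i j
    rw [coe_pellAutomorph]
    fin_cases i <;> fin_cases j <;> simp [hps, hq, hu]

theorem finite_setOf_transformedCoeffs {a c : ℤ} (hneg : a * c < 0) (X : ℝ) :
    {k : ℤ × ℤ × ℤ | ∃ g : Matrix.SpecialLinearGroup (Fin 2) ℤ,
      |(g 0 0 : ℝ) ^ 2 - ((a : ℝ) / c) * (g 0 1 : ℝ) ^ 2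
        + ((c : ℝ) / a) * (g 1 0 : ℝ) ^ 2 - (g 1 1 : ℝ) ^ 2| ≤ X ∧
      k = transformedCoeffs a c g}.Finite := by
  have ha : (a : ℝ) ≠ 0 := by rintro h; simp_all
  have hc : (c : ℝ) ≠ 0 := by rintro h; simp_all
  have hneg' : (a : ℝ) * c < 0 := by exact_mod_cast hneg
  obtain ⟨A, hA⟩ := exists_nat_ge (|(a : ℝ)| * (X + 1))
  obtain ⟨B, hB⟩ := exists_nat_ge (-((a : ℝ) * c) * ((X + 1) ^ 2 + 1))
  obtain ⟨C, hC⟩ := exists_nat_ge (|(c : ℝ)| * (X + 1))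
  refine ((Set.finite_Icc (-(A : ℤ)) A).prod
    ((Set.finite_Icc (-(B : ℤ)) B).prod (Set.finite_Icc (-(C : ℤ)) C))).subset ?_
  rintro _ ⟨g, hg, rfl⟩
  have hX : 0 ≤ X := (abs_nonneg _).trans hg
  have hdet := g.det_coe
  rw [Matrix.det_fin_two] at hdet
  have hid : (a * g 0 0 ^ 2 + c * g 1 0 ^ 2) * (a * g 0 1 ^ 2 + c * g 1 1 ^ 2) =
      (a * g 0 0 * g 0 1 + c * g 1 0 * g 1 1) ^ 2 + a * c := by
    linear_combination a * c * (g 0 0 * g 1 1 - g 0 1 * g 1 0 + 1) * hdet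
  have hx : (g 0 0 : ℝ) ^ 2 - ((a : ℝ) / c) * (g 0 1 : ℝ) ^ 2
        + ((c : ℝ) / a) * (g 1 0 : ℝ) ^ 2 - (g 1 1 : ℝ) ^ 2 =
      ((a * g 0 0 ^ 2 + c * g 1 0 ^ 2 : ℤ) : ℝ) / a
        + -((a * g 0 1 ^ 2 + c * g 1 1 ^ 2 : ℤ) : ℝ) / c := by
    push_cast
    field_simp
    ring
  rw [hx] at hg
  simp only [transformedCoeffs]
  generalize a * g 0 0 ^ 2 + c * g 1 0 ^ 2 = P at *
  generalize a * g 0 0 * g 0 1 + c * g 1 0 * g 1 1 = R at *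
  generalize a * g 0 1 ^ 2 + c * g 1 1 ^ 2 = S at *
  have hid' : (P : ℝ) * S = R ^ 2 + a * c := by exact_mod_cast hid
  obtain ⟨x, hxP⟩ : ∃ x : ℝ, x = P / a := ⟨_, rfl⟩
  obtain ⟨y, hyS⟩ : ∃ y : ℝ, y = -(S : ℝ) / c := ⟨_, rfl⟩
  rw [← hxP, ← hyS] at hg
  have hP : (P : ℝ) = a * x := by rw [hxP]; field_simp
  have hS : (S : ℝ) = -(c * y) := by rw [hyS]; field_simp
  have hR : (R : ℝ) ^ 2 = -((a : ℝ) * c) * (x * y + 1) := by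
    rw [hP, hS] at hid'
    linear_combination -hid'
  have hxy : 0 ≤ x * y + 1 := by
    by_contra! h
    nlinarith [sq_nonneg (R : ℝ)]
  have hsub : |x - y| ≤ X + 2 := by
    apply abs_le_of_sq_le_sq _ (by linarith)
    nlinarith [sq_le_sq' (abs_le.mp hg).1 (abs_le.mp hg).2]
  have hbx : |x| ≤ X + 1 := by
    rw [abs_le] at *
    constructor <;> linarith
  have hby : |y| ≤ X + 1 := by
    rw [abs_le] at *
    constructor <;> linarith
  have hbxy : x * y ≤ (X + 1) ^ 2 := by
    calc x * y ≤ |x * y| := le_abs_self _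
      _ = |x| * |y| := abs_mul _ _
      _ ≤ (X + 1) * (X + 1) := by gcongr
      _ = _ := by ring
  have mem {n : ℤ} {N : ℕ} (h : |(n : ℝ)| ≤ N) : n ∈ Set.Icc (-(N : ℤ)) N := by
    rw [Set.mem_Icc, ← abs_le]
    exact_mod_cast h
  refine ⟨mem ?_, mem ?_, mem ?_⟩
  · rw [hP, abs_mul]
    exact le_trans (by gcongr) hA
  · have h1 : |R| ≤ R ^ 2 := by
      rw [← sq_abs]
      exact Int.le_self_sq _
    have h2 : |(R : ℝ)| ≤ (R : ℝ) ^ 2 := by exact_mod_cast h1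
    refine h2.trans (le_trans ?_ hB)
    rw [hR]
    have : 0 ≤ -((a : ℝ) * c) := by linarith
    gcongr
  · rw [hS, abs_neg, abs_mul]
    exact le_trans (by gcongr) hC

theorem stmt_15 (a c : ℤ) (hac : IsCoprime a c)
    (d : ℤ) (hd : d = -4 * a * c) (hd_pos : 0 < d) (hd_ns : ¬ IsSquare d)
    (t₀ u₀ : ℤ) (ht₀ : 0 < t₀) (hu₀ : 0 < u₀)
    (hPell : t₀ ^ 2 - d * u₀ ^ 2 = 4)
    (hmin : ∀ t u : ℤ, 0 < t → 0 < u → t ^ 2 - d * u ^ 2 = 4 → t₀ ≤ t)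
    (M : Matrix.SpecialLinearGroup (Fin 2) ℤ)
    (hM : (M : Matrix (Fin 2) (Fin 2) ℤ) = !![t₀ / 2, -c * u₀; a * u₀, t₀ / 2])
    (FQ : Matrix (Fin 2) (Fin 2) ℤ → ℝ)
    (hFQ : ∀ N : Matrix (Fin 2) (Fin 2) ℤ,
      FQ N = (N 0 0 : ℝ) ^ 2 - ((a : ℝ) / c) * (N 0 1 : ℝ) ^ 2
        + ((c : ℝ) / a) * (N 1 0 : ℝ) ^ 2 - (N 1 1 : ℝ) ^ 2) :
    (∀ N : Matrix (Fin 2) (Fin 2) ℤ,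
        FQ ((M : Matrix (Fin 2) (Fin 2) ℤ) * N) = FQ N) ∧
    ∀ X : ℝ, 0 < X →
      Set.Finite {s : Set (Matrix.SpecialLinearGroup (Fin 2) ℤ) |
        ∃ g : Matrix.SpecialLinearGroup (Fin 2) ℤ,
          |FQ (g : Matrix (Fin 2) (Fin 2) ℤ)| ≤ X ∧
          s = {g' | ∃ n : ℤ, g' = M ^ n * g}} := by
  subst hd
  have hneg : a * c < 0 := by linarith
  have ha : a ≠ 0 := by rintro rfl; simp at hneg
  have hc : c ≠ 0 := by rintro rfl; simp at hneg
  obtain ⟨p, rfl⟩ : (2 : ℤ) ∣ t₀ :=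
    Int.prime_two.dvd_of_dvd_pow (n := 2) ⟨2 - 2 * a * c * u₀ ^ 2, by linear_combination hPell⟩
  have hp : p ^ 2 - (-a * c) * u₀ ^ 2 = 1 := by linarith
  obtain ⟨s₀, hs₀⟩ : ∃ s, s = Pell.Solution₁.mk p u₀ hp := ⟨_, rfl⟩
  have hMs : M = pellAutomorph a c s₀ := by
    apply Subtype.ext
    rw [hM, coe_pellAutomorph, hs₀]
    simp
  have hfund : Pell.IsFundamental s₀ := by
    subst hs₀
    refine ⟨?_, hu₀, fun {b} hb => ?_⟩
    · rw [Pell.Solution₁.x_mk]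
      nlinarith [mul_pos (neg_pos.mpr hneg) (pow_pos hu₀ 2)]
    · have hy : b.y ≠ 0 := by
        intro h
        have := b.prop
        rw [h] at this
        nlinarith
      have := hmin (2 * b.x) |b.y| (by linarith) (abs_pos.mpr hy)
        (by rw [sq_abs]; linear_combination 4 * b.prop)
      rw [Pell.Solution₁.x_mk]
      linarith
  refine ⟨fun N => ?_, fun X _ => ?_⟩
  · have ha' : (a : ℝ) ≠ 0 := by exact_mod_cast ha
    have hc' : (c : ℝ) ≠ 0 := by exact_mod_cast hc
    have hp' : (p : ℝ) ^ 2 - (-a * c) * (u₀ : ℝ) ^ 2 = 1 := by exact_mod_cast hp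
    rw [hFQ, hFQ, hMs, coe_pellAutomorph, hs₀]
    simp only [Matrix.mul_apply, Fin.sum_univ_two, Pell.Solution₁.x_mk, Pell.Solution₁.y_mk,
      Matrix.of_apply, Matrix.cons_val', Matrix.cons_val_zero, Matrix.cons_val_one,
      Matrix.cons_val_fin_one]
    push_cast
    field_simp
    linear_combination
      (a * c * N 0 0 ^ 2 + c ^ 2 * N 1 0 ^ 2 - a ^ 2 * N 0 1 ^ 2 - a * c * N 1 1 ^ 2 : ℝ) * hp'
  · refine (((finite_setOf_transformedCoeffs hneg X).prod
      (Set.toFinite {(1 : Pell.Solution₁ (-a * c)), -1})).image fun q =>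
        {g' | ∃ n : ℤ, g' = M ^ n * (pellAutomorph a c q.2 *
          Function.invFun (transformedCoeffs a c) q.1)}).subset ?_
    rintro _ ⟨g, hg, rfl⟩
    rw [hFQ] at hg
    obtain ⟨s, hs⟩ := exists_pellAutomorph_mul_eq ha hac
      (Function.invFun_eq (f := transformedCoeffs a c) ⟨g, rfl⟩).symm
    obtain ⟨n, e, he, rfl⟩ : ∃ (n : ℤ) (e : Pell.Solution₁ (-a * c)),
        e ∈ ({1, -1} : Set (Pell.Solution₁ (-a * c))) ∧ s = s₀ ^ n * e := by
      obtain ⟨n, h | h⟩ := hfund.eq_zpow_or_neg_zpow s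
      · exact ⟨n, 1, by simp, by simp [h]⟩
      · exact ⟨n, -1, by simp, by simp [h]⟩
    refine ⟨(transformedCoeffs a c g, e), ⟨⟨g, hg, rfl⟩, he⟩, ?_⟩
    rw [map_mul, map_zpow, ← hMs, mul_assoc] at hs
    ext g'
    simp only [Set.mem_ofPred_eq]
    generalize pellAutomorph a c e * Function.invFun (transformedCoeffs a c)
      (transformedCoeffs a c g) = w at *
    subst hs
    constructor
    · rintro ⟨m, rfl⟩
      exact ⟨m - n, by rw [← mul_assoc, ← _root_.zpow_add, sub_add_cancel]⟩
    · rintro ⟨m, rfl⟩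
      exact ⟨m + n, by rw [← mul_assoc, ← _root_.zpow_add]⟩
end
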